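/- Let n ≥ 1, let μ ∈ P_{n−1} and r > 0, and let (μ^k)_{k∈ℕ} be a sequence in P_{n−1} and (r_k)_{k∈ℕ} a sequence of positive reals. Then the following are equivalent: (a) there exist sequences A_k ∈ U(n) and B_k ∈ W such that ( A_k (J_{μ^k} + B_k) A_k*, A_k v_{r_k}, 0 ) converges to (J_μ, v_r, 0) in M_n(ℂ) × ℂ^n × ℝ; (b) lim_{k→∞} r_k = r and μ^k = μ for all sufficiently large k. (This expresses that the coadjoint orbits O_{(μ^k,r_k)} of U(n)⋉H_n converge to the orbit O_{(μ,r)}.) -/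

import Mathlib

open Matrix Filter

/-- `J_μ = diag(iμ₁,…,iμ_{n-1},0)` for `μ ∈ ℤ^{n-1}` (indexed `0,…,n-2`). -/
noncomputable def Jmu (n : ℕ) (μ : ℕ → ℤ) : Matrix (Fin n) (Fin n) ℂ :=
  Matrix.diagonal fun i => if (i : ℕ) < n - 1 then Complex.I * (μ (i : ℕ) : ℂ) else 0

/-- `v_r = (0,…,0,r)ᵀ ∈ ℂ^n`. -/
noncomputable def vr (n : ℕ) (r : ℝ) : Fin n → ℂ := fun i =>
  if (i : ℕ) = n - 1 then (r : ℂ) else 0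

/-- The orthogonal projection of `ℂ^(m+1)` killing the last basis vector. -/
noncomputable def projInit (m : ℕ) : Matrix (Fin (m + 1)) (Fin (m + 1)) ℂ :=
  1 - Matrix.single (Fin.last m) (Fin.last m) 1

theorem projInit_eq_diagonal (m : ℕ) :
    projInit m = Matrix.diagonal fun i : Fin (m + 1) => if (i : ℕ) < m then (1 : ℂ) else 0 := by
  ext i j
  simp only [projInit, Matrix.sub_apply, Matrix.one_apply, Matrix.single_apply,
    Matrix.diagonal_apply]
  by_cases hij : i = j
  · subst hij
    by_cases hi : (i : ℕ) < m
    · have h : Fin.last m ≠ i := fun h => by simp [← h] at hi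
      simp [hi, h]
    · have h : Fin.last m = i := Fin.ext (by simp only [Fin.val_last]; lia)
      simp [hi, h]
  · have h : ¬ (Fin.last m = i ∧ Fin.last m = j) := fun h => hij (h.1.symm.trans h.2)
    simp [hij, h]

theorem projInit_mul_Jmu_mul_projInit (m : ℕ) (μ : ℕ → ℤ) :
    projInit m * Jmu (m + 1) μ * projInit m = Jmu (m + 1) μ := by
  rw [projInit_eq_diagonal, Jmu, Matrix.diagonal_mul_diagonal, Matrix.diagonal_mul_diagonal]
  congr 1
  ext i
  by_cases hi : (i : ℕ) < m <;> simp [hi]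

theorem projInit_mul_mul_projInit_eq_zero (m : ℕ) (B : Matrix (Fin (m + 1)) (Fin (m + 1)) ℂ)
    (hB : ∀ i j : Fin (m + 1), (i : ℕ) < m → (j : ℕ) < m → B i j = 0) :
    projInit m * B * projInit m = 0 := by
  rw [projInit_eq_diagonal]
  ext i j
  rw [Matrix.mul_diagonal, Matrix.diagonal_mul]
  by_cases hi : (i : ℕ) < m <;> by_cases hj : (j : ℕ) < m <;> simp [hi, hj]
  exact hB i j hi hj

theorem mulVec_vr (m : ℕ) (A : Matrix (Fin (m + 1)) (Fin (m + 1)) ℂ) (r : ℝ) (i : Fin (m + 1)) :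
    A.mulVec (vr (m + 1) r) i = A i (Fin.last m) * r := by
  rw [Matrix.mulVec, dotProduct, Fin.sum_univ_castSucc]
  have h : ∀ x : Fin m, (x : ℕ) ≠ m := fun x => x.isLt.ne
  simp [vr, h]

theorem sum_norm_sq_col_of_mem_unitaryGroup {n : ℕ} {A : Matrix (Fin n) (Fin n) ℂ}
    (hA : A ∈ Matrix.unitaryGroup (Fin n) ℂ) (j : Fin n) : ∑ i, ‖A i j‖ ^ 2 = 1 := by
  have h := congrFun (congrFun (Matrix.mem_unitaryGroup_iff'.1 hA) j) j
  rw [Matrix.star_eq_conjTranspose, Matrix.mul_apply] at h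
  simp only [Matrix.conjTranspose_apply, Matrix.one_apply_eq, RCLike.star_def,
    Complex.conj_mul'] at h
  exact_mod_cast h

theorem sum_norm_sq_mulVec_vr {m : ℕ} {A : Matrix (Fin (m + 1)) (Fin (m + 1)) ℂ}
    (hA : A ∈ Matrix.unitaryGroup (Fin (m + 1)) ℂ) (r : ℝ) :
    ∑ i, ‖A.mulVec (vr (m + 1) r) i‖ ^ 2 = r ^ 2 := by
  simp only [mulVec_vr, norm_mul, mul_pow, ← Finset.sum_mul,
    sum_norm_sq_col_of_mem_unitaryGroup hA]
  simp

theorem tendsto_radius {m : ℕ} {A : ℕ → Matrix (Fin (m + 1)) (Fin (m + 1)) ℂ}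
    (hA : ∀ k, A k ∈ Matrix.unitaryGroup (Fin (m + 1)) ℂ) {r : ℝ} (hr : 0 < r) {s : ℕ → ℝ}
    (hs : ∀ k, 0 < s k)
    (h : Tendsto (fun k => (A k).mulVec (vr (m + 1) (s k))) atTop (nhds (vr (m + 1) r))) :
    Tendsto s atTop (nhds r) := by
  have hsq : Tendsto (fun k => s k ^ 2) atTop (nhds (r ^ 2)) := by
    have h1 : Tendsto (fun k => ∑ i, ‖(A k).mulVec (vr (m + 1) (s k)) i‖ ^ 2) atTop
        (nhds (∑ i, ‖vr (m + 1) r i‖ ^ 2)) :=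
      tendsto_finsetSum _ fun i _ => ((tendsto_pi_nhds.1 h i).norm).pow 2
    have h2 := sum_norm_sq_mulVec_vr (one_mem (Matrix.unitaryGroup (Fin (m + 1)) ℂ)) r
    rw [Matrix.one_mulVec] at h2
    simpa only [sum_norm_sq_mulVec_vr (hA _), h2] using h1
  simpa only [Real.sqrt_sq (hs _).le, Real.sqrt_sq hr.le] using hsq.sqrt

theorem tendsto_conj_projInit {m : ℕ} {A : ℕ → Matrix (Fin (m + 1)) (Fin (m + 1)) ℂ}
    (hA : ∀ k, A k ∈ Matrix.unitaryGroup (Fin (m + 1)) ℂ) {r : ℝ} (hr : 0 < r) {s : ℕ → ℝ}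
    (hs : ∀ k, 0 < s k)
    (h : Tendsto (fun k => (A k).mulVec (vr (m + 1) (s k))) atTop (nhds (vr (m + 1) r))) :
    Tendsto (fun k => A k * projInit m * (A k)ᴴ) atTop (nhds (projInit m)) := by
  have hlim := tendsto_radius hA hr hs h
  have hcol : ∀ i, Tendsto (fun k => A k i (Fin.last m)) atTop
      (nhds ((1 : Matrix (Fin (m + 1)) (Fin (m + 1)) ℂ) i (Fin.last m))) := by
    intro i
    have h1 := (tendsto_pi_nhds.1 h i).div (Complex.continuous_ofReal.tendsto r |>.comp hlim)
      (by exact_mod_cast hr.ne')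
    have h2 := mulVec_vr m 1 r i
    rw [Matrix.one_mulVec] at h2
    rw [h2, mul_div_cancel_right₀ _ (by exact_mod_cast hr.ne')] at h1
    refine h1.congr fun k => ?_
    simp only [Pi.div_apply, mulVec_vr, Function.comp]
    exact mul_div_cancel_right₀ _ (by exact_mod_cast (hs k).ne')
  have hentry : ∀ (C : Matrix (Fin (m + 1)) (Fin (m + 1)) ℂ) (i j : Fin (m + 1)),
      (C * Matrix.single (Fin.last m) (Fin.last m) 1 * Cᴴ :
        Matrix (Fin (m + 1)) (Fin (m + 1)) ℂ) i j
        = C i (Fin.last m) * star (C j (Fin.last m)) := by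
    intro C i j
    rw [Matrix.mul_apply, Finset.sum_eq_single (Fin.last m)]
    · simp
    · intro b _ hb
      rw [Matrix.mul_single_apply_of_ne _ _ _ _ _ hb, zero_mul]
    · simp
  have hE : Tendsto (fun k => A k * Matrix.single (Fin.last m) (Fin.last m) 1 * (A k)ᴴ) atTop
      (nhds (1 * Matrix.single (Fin.last m) (Fin.last m) 1 * 1ᴴ)) := by
    refine tendsto_pi_nhds.2 fun i => tendsto_pi_nhds.2 fun j => ?_
    simp only [hentry]
    exact (hcol i).mul (hcol j).star
  rw [Matrix.conjTranspose_one, mul_one, one_mul] at hE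
  refine (hE.const_sub 1).congr fun k => ?_
  have hAk : A k * (A k)ᴴ = 1 := Matrix.mem_unitaryGroup_iff.1 (hA k)
  rw [projInit, mul_sub, sub_mul, mul_one, hAk]

theorem tendsto_conj_Jmu {m : ℕ} {A B : ℕ → Matrix (Fin (m + 1)) (Fin (m + 1)) ℂ}
    (hA : ∀ k, A k ∈ Matrix.unitaryGroup (Fin (m + 1)) ℂ)
    (hB : ∀ k (i j : Fin (m + 1)), (i : ℕ) < m → (j : ℕ) < m → B k i j = 0)
    {μ : ℕ → ℤ} {ν : ℕ → ℕ → ℤ}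
    (hP : Tendsto (fun k => A k * projInit m * (A k)ᴴ) atTop (nhds (projInit m)))
    (hJ : Tendsto (fun k => A k * (Jmu (m + 1) (ν k) + B k) * (A k)ᴴ) atTop
      (nhds (Jmu (m + 1) μ))) :
    Tendsto (fun k => A k * Jmu (m + 1) (ν k) * (A k)ᴴ) atTop (nhds (Jmu (m + 1) μ)) := by
  have h := (hP.mul hJ).mul hP
  rw [projInit_mul_Jmu_mul_projInit] at h
  refine h.congr fun k => ?_
  have hAk : (A k)ᴴ * A k = 1 := Matrix.mem_unitaryGroup_iff'.1 (hA k)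
  have hcomp : projInit m * (Jmu (m + 1) (ν k) + B k) * projInit m = Jmu (m + 1) (ν k) := by
    rw [mul_add, add_mul, projInit_mul_Jmu_mul_projInit,
      projInit_mul_mul_projInit_eq_zero m _ (hB k), add_zero]
  calc A k * projInit m * (A k)ᴴ * (A k * (Jmu (m + 1) (ν k) + B k) * (A k)ᴴ)
        * (A k * projInit m * (A k)ᴴ)
      = A k * projInit m * ((A k)ᴴ * A k) * (Jmu (m + 1) (ν k) + B k) * ((A k)ᴴ * A k)
        * projInit m * (A k)ᴴ := by simp only [mul_assoc]
    _ = A k * (projInit m * (Jmu (m + 1) (ν k) + B k) * projInit m) * (A k)ᴴ := by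
        simp only [hAk, mul_one, mul_assoc]
    _ = _ := by rw [hcomp]

theorem det_smul_one_add_I_smul_Jmu (m : ℕ) (μ : ℕ → ℤ) (t : ℤ) :
    ((t : ℂ) • (1 : Matrix (Fin (m + 1)) (Fin (m + 1)) ℂ) + Complex.I • Jmu (m + 1) μ).det
      = (((∏ i : Fin m, (t - μ i)) * t : ℤ) : ℂ) := by
  have h : (t : ℂ) • (1 : Matrix (Fin (m + 1)) (Fin (m + 1)) ℂ) + Complex.I • Jmu (m + 1) μ
      = Matrix.diagonal fun i : Fin (m + 1) => if (i : ℕ) < m then (t : ℂ) - μ i else t := by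
    rw [Jmu, ← Matrix.diagonal_one, ← Matrix.diagonal_smul, ← Matrix.diagonal_smul,
      Matrix.diagonal_add]
    congr 1
    ext i
    by_cases hi : (i : ℕ) < m
    · simp [hi, ← mul_assoc, sub_eq_add_neg]
    · simp [hi]
  rw [h, Matrix.det_diagonal, Fin.prod_univ_castSucc]
  simp

theorem det_smul_one_add_I_smul_conj {n : ℕ} {A : Matrix (Fin n) (Fin n) ℂ}
    (hA : A ∈ Matrix.unitaryGroup (Fin n) ℂ) (J : Matrix (Fin n) (Fin n) ℂ) (t : ℂ) :
    (t • (1 : Matrix (Fin n) (Fin n) ℂ) + Complex.I • (A * J * Aᴴ)).det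
      = (t • (1 : Matrix (Fin n) (Fin n) ℂ) + Complex.I • J).det := by
  have h1 : A * Aᴴ = 1 := Matrix.mem_unitaryGroup_iff.1 hA
  have h : t • (1 : Matrix (Fin n) (Fin n) ℂ) + Complex.I • (A * J * Aᴴ)
      = A * (t • (1 : Matrix (Fin n) (Fin n) ℂ) + Complex.I • J) * Aᴴ := by
    simp [mul_add, add_mul, h1]
  rw [h, Matrix.det_mul_right_comm, h1, one_mul]

/-- A sequence of integers converging in `ℂ` to an integer is eventually constant. -/
theorem eventually_eq_of_tendsto_intCast {a : ℕ → ℤ} {b : ℤ}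
    (h : Tendsto (fun k => (a k : ℂ)) atTop (nhds (b : ℂ))) : ∀ᶠ k in atTop, a k = b := by
  have h1 : Tendsto (fun k => ‖(a k : ℂ) - b‖) atTop (nhds 0) :=
    tendsto_iff_norm_sub_tendsto_zero.1 h
  filter_upwards [h1.eventually_lt_const one_pos] with k hk
  rw [← Int.cast_sub, Complex.norm_intCast] at hk
  have hk' : |a k - b| < 1 := by exact_mod_cast hk
  exact sub_eq_zero.1 (Int.abs_lt_one_iff.1 hk')

/-- Antitone integer tuples whose monic polynomials agree at `1, …, m + 1` are equal. -/
theorem eq_of_antitone_of_prod_sub_eq {m : ℕ} {f g : Fin m → ℤ} (hf : Antitone f)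
    (hg : Antitone g)
    (h : ∀ t : Fin (m + 1), ∏ i, ((t : ℤ) + 1 - f i) = ∏ i, ((t : ℤ) + 1 - g i)) : f = g := by
  let p : (Fin m → ℤ) → Polynomial ℤ := fun u => ∏ i, (Polynomial.X - Polynomial.C (u i))
  have hdeg : ∀ u, (p u).natDegree < Fintype.card (Fin (m + 1)) := fun u => by
    have := Polynomial.natDegree_finsetProd_X_sub_C_eq_card Finset.univ u
    rw [this]
    simp
  have hp : p f = p g := by
    refine Polynomial.eq_of_natDegree_lt_card_of_eval_eq (p f) (p g)
      (f := fun t : Fin (m + 1) => (t : ℤ) + 1) ?_ ?_ ?_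
    · intro a b hab
      exact Fin.ext (by simpa using hab)
    · intro t
      simpa [p, Polynomial.eval_prod] using h t
    · exact max_lt (hdeg f) (hdeg g)
  have hroots : ∀ u : Fin m → ℤ, (p u).roots = (List.ofFn u : Multiset ℤ) := fun u => by
    have : p u = ((List.ofFn u : Multiset ℤ).map
        fun a => Polynomial.X - Polynomial.C a).prod := by
      simp [p, List.prod_ofFn]
    rw [this, Polynomial.roots_multiset_prod_X_sub_C]
  have hperm : (List.ofFn f).Perm (List.ofFn g) := by
    rw [← Multiset.coe_eq_coe, ← hroots, ← hroots, hp]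
  exact List.ofFn_injective (hperm.eq_of_pairwise (le := (· ≥ ·))
    (fun a b _ _ h1 h2 => le_antisymm h2 h1)
    (List.pairwise_ofFn.2 fun i j hij => hf hij.le)
    (List.pairwise_ofFn.2 fun i j hij => hg hij.le))

theorem antitone_fin_of_succ_le {m : ℕ} {u : ℕ → ℤ} (hu : ∀ i, i + 1 < m → u (i + 1) ≤ u i) :
    Antitone fun i : Fin m => u i := by
  intro i j hij
  have key : ∀ d a, a + d < m → u (a + d) ≤ u a := by
    intro d
    induction d with
    | zero => intro a _; exact le_rfl
    | succ d ih => intro a ha; exact (hu (a + d) ha).trans (ih a (by lia))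
  have hij' : (i : ℕ) ≤ j := hij
  have := key (j - i) i (by lia)
  rwa [Nat.add_sub_cancel' hij'] at this

theorem eventually_eq_of_tendsto_conj_Jmu {m : ℕ}
    {A : ℕ → Matrix (Fin (m + 1)) (Fin (m + 1)) ℂ}
    (hA : ∀ k, A k ∈ Matrix.unitaryGroup (Fin (m + 1)) ℂ) {μ : ℕ → ℤ}
    (hμ : ∀ i, i + 1 < m → μ (i + 1) ≤ μ i) {ν : ℕ → ℕ → ℤ}
    (hν : ∀ k i, i + 1 < m → ν k (i + 1) ≤ ν k i)
    (h : Tendsto (fun k => A k * Jmu (m + 1) (ν k) * (A k)ᴴ) atTop (nhds (Jmu (m + 1) μ))) :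
    ∀ᶠ k in atTop, ∀ j < m, ν k j = μ j := by
  have hdet : ∀ t : ℤ, ∀ᶠ k in atTop,
      (∏ i : Fin m, (t - ν k i)) * t = (∏ i : Fin m, (t - μ i)) * t := by
    intro t
    have hc : Continuous fun M : Matrix (Fin (m + 1)) (Fin (m + 1)) ℂ =>
        ((t : ℂ) • (1 : Matrix (Fin (m + 1)) (Fin (m + 1)) ℂ) + Complex.I • M).det :=
      by
      refine Continuous.matrix_det ?_
      fun_prop
    have h1 := (hc.tendsto _).comp h
    simp only [Function.comp_def, det_smul_one_add_I_smul_conj (hA _),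
      det_smul_one_add_I_smul_Jmu] at h1
    exact eventually_eq_of_tendsto_intCast h1
  filter_upwards [eventually_all.2 fun t : Fin (m + 1) => hdet ((t : ℤ) + 1)] with k hk j hj
  have := eq_of_antitone_of_prod_sub_eq (antitone_fin_of_succ_le (hν k))
    (antitone_fin_of_succ_le hμ) fun t => mul_right_cancel₀ (by positivity) (hk t)
  exact congrFun this ⟨j, hj⟩

theorem stmt9 (n : ℕ) (hn : 1 ≤ n) (μ : ℕ → ℤ)
    (hμ : ∀ i, i + 1 < n - 1 → μ (i + 1) ≤ μ i) (r : ℝ) (hr : 0 < r)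
    (muk : ℕ → ℕ → ℤ) (hmuk : ∀ k i, i + 1 < n - 1 → muk k (i + 1) ≤ muk k i)
    (rk : ℕ → ℝ) (hrk : ∀ k, 0 < rk k) :
    (∃ (A B : ℕ → Matrix (Fin n) (Fin n) ℂ),
        (∀ k, A k ∈ Matrix.unitaryGroup (Fin n) ℂ) ∧
        (∀ k, (B k)ᴴ = -(B k) ∧
          ∀ i j : Fin n, (i : ℕ) < n - 1 → (j : ℕ) < n - 1 → B k i j = 0) ∧
        Tendsto (fun k =>
            ((A k) * (Jmu n (muk k) + B k) * (A k)ᴴ,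
              (A k).mulVec (vr n (rk k)),
              (0 : ℝ)))
          atTop
          (nhds (Jmu n μ, vr n r, (0 : ℝ))))
      ↔ (Tendsto rk atTop (nhds r) ∧ ∀ᶠ k in atTop, ∀ j < n - 1, muk k j = μ j) := by
  obtain ⟨m, rfl⟩ : ∃ m, n = m + 1 := ⟨n - 1, by lia⟩
  simp only [Nat.add_sub_cancel] at hμ hmuk ⊢
  constructor
  · rintro ⟨A, B, hA, hB, h⟩
    have hJ := h.fst_nhds
    have hv := h.snd_nhds.fst_nhds
    exact ⟨tendsto_radius hA hr hrk hv, eventually_eq_of_tendsto_conj_Jmu hA hμ hmuk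
      (tendsto_conj_Jmu hA (fun k => (hB k).2) (tendsto_conj_projInit hA hr hrk hv) hJ)⟩
  · rintro ⟨hlim, heq⟩
    refine ⟨fun _ => 1, fun _ => 0, fun _ => one_mem _, fun _ => by simp, ?_⟩
    simp only [add_zero, one_mul, Matrix.conjTranspose_one, mul_one, Matrix.one_mulVec]
    refine Tendsto.prodMk_nhds (tendsto_nhds_of_eventually_eq ?_)
      (Tendsto.prodMk_nhds (tendsto_pi_nhds.2 fun i => ?_) tendsto_const_nhds)
    · filter_upwards [heq] with k hk
      rw [Jmu, Jmu]
      congr 1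
      ext i
      by_cases hi : (i : ℕ) < m
      · simp [hi, hk i hi]
      · simp [hi]
    · by_cases hi : (i : ℕ) = m
      · simpa [vr, hi, Function.comp_def] using (Complex.continuous_ofReal.tendsto r).comp hlim
      · simp [vr, hi]
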